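/- Let Σ be an n×n real positive semidefinite matrix with Σ_ii = 1 for all i, let Z be a random vector distributed according to the centered multivariate Gaussian measure on ℝ^n with covariance Σ, and let G be a random vector of n independent standard Gaussians (centered multivariate Gaussian with identity covariance). Then E[max_{1≤i≤n} |Z_i|] ≤ E[max_{1≤i≤n} |G_i|]. -/

import Mathlib

open MeasureTheory ProbabilityTheory

noncomputable section

/-- A probability measure `μ` on `ℝ^n` is the centered Gaussian with covariance matrix `S`
iff every linear functional `x ↦ ∑ i, c i * x i` pushes `μ` forward to the real Gaussian
with mean `0` and variance `cᵀ S c`. -/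
def IsCenteredGaussianWithCov {n : ℕ} (μ : Measure (Fin n → ℝ))
    (S : Matrix (Fin n) (Fin n) ℝ) : Prop :=
  IsProbabilityMeasure μ ∧
    ∀ c : Fin n → ℝ,
      μ.map (fun x => ∑ i, c i * x i) =
        gaussianReal 0 (Real.toNNReal (∑ i, ∑ j, c i * S i j * c j))


open Pointwise in
lemma bm_compact {A B C : Set ℝ} (hA : IsCompact A) (hB : IsCompact B) (hAn : A.Nonempty)
    (hBn : B.Nonempty) {a b : ℝ} (ha : 0 < a) (hb : 0 < b)
    (h : ∀ x ∈ A, ∀ y ∈ B, a * x + b * y ∈ C) :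
    ENNReal.ofReal a * volume A + ENNReal.ofReal b * volume B ≤ volume C := by
  obtain ⟨x1, hx1, hx1'⟩ := hA.exists_isGreatest hAn
  obtain ⟨y0, hy0, hy0'⟩ := hB.exists_isLeast hBn
  set U : Set ℝ := (fun z => z + b * y0) '' (a • A)
  set V : Set ℝ := (fun z => a * x1 + z) '' (b • B)
  have hU : volume U = ENNReal.ofReal a * volume A := by
    simp only [U]
    rw [Set.image_add_right, measure_preimage_add_right, Measure.addHaar_smul]
    simp [abs_of_pos ha]
  have hV : volume V = ENNReal.ofReal b * volume B := by
    simp only [V]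
    rw [Set.image_add_left, measure_preimage_add, Measure.addHaar_smul]
    simp [abs_of_pos hb]
  have hUm : MeasurableSet V := by
    apply IsCompact.measurableSet
    exact (hB.smul b).image (by fun_prop)
  have hdisj : AEDisjoint volume U V := by
    refine measure_mono_null (t := {a * x1 + b * y0}) ?_ (by simp)
    rintro z ⟨⟨_, ⟨x, hx, rfl⟩, rfl⟩, ⟨_, ⟨y, hy, rfl⟩, hz⟩⟩
    have e1 : a * x ≤ a * x1 := mul_le_mul_of_nonneg_left (hx1' hx) ha.le
    have e2 : b * y0 ≤ b * y := mul_le_mul_of_nonneg_left (hy0' hy) hb.le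
    simp only [smul_eq_mul, Set.mem_singleton_iff] at *
    linarith
  rw [← hU, ← hV, ← measure_union₀ hUm.nullMeasurableSet hdisj]
  apply measure_mono
  rintro z (⟨_, ⟨x, hx, rfl⟩, rfl⟩ | ⟨_, ⟨y, hy, rfl⟩, rfl⟩)
  · exact h x hx y0 hy0
  · exact h x1 hx1 y hy

lemma bm_meas {A B C : Set ℝ} (hA : MeasurableSet A) (hB : MeasurableSet B) (hAn : A.Nonempty)
    (hBn : B.Nonempty) {a b : ℝ} (ha : 0 < a) (hb : 0 < b)
    (h : ∀ x ∈ A, ∀ y ∈ B, a * x + b * y ∈ C) :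
    ENNReal.ofReal a * volume A + ENNReal.ofReal b * volume B ≤ volume C := by
  obtain ⟨x0, hx0⟩ := hAn
  obtain ⟨y0, hy0⟩ := hBn
  have key : ∀ K ⊆ A, IsCompact K → ∀ L ⊆ B, IsCompact L →
      ENNReal.ofReal a * volume K + ENNReal.ofReal b * volume L ≤ volume C := by
    intro K hK hKc L hL hLc
    refine le_trans ?_ (bm_compact (hKc.insert x0) (hLc.insert y0) ⟨x0, by simp⟩ ⟨y0, by simp⟩ ha hb
      (C := C) ?_)
    · gcongr <;> exact Set.subset_insert _ _
    · intro x hx y hy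
      exact h x (Set.insert_subset hx0 hK hx) y (Set.insert_subset hy0 hL hy)
  have key2 : ∀ L ⊆ B, IsCompact L →
      ENNReal.ofReal a * volume A + ENNReal.ofReal b * volume L ≤ volume C := by
    intro L hL hLc
    have hfin : ENNReal.ofReal b * volume L ≠ ⊤ :=
      ENNReal.mul_ne_top (by simp) hLc.measure_lt_top.ne
    by_contra hcon
    push Not at hcon
    rw [hA.measure_eq_iSup_isCompact] at hcon
    simp only [ENNReal.mul_iSup] at hcon
    have : volume C - ENNReal.ofReal b * volume L < ⨆ K, ⨆ (_ : K ⊆ A), ⨆ (_ : IsCompact K), ENNReal.ofReal a * volume K := by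
      refine ENNReal.sub_lt_of_lt_add ?_ hcon
      simpa using key ∅ (by simp) isCompact_empty L hL hLc
    simp only [lt_iSup_iff] at this
    obtain ⟨K, hK, hKc, hlt⟩ := this
    have := key K hK hKc L hL hLc
    exact absurd hlt (not_lt.2 (ENNReal.le_sub_of_add_le_right hfin this))
  by_cases hAt : ENNReal.ofReal a * volume A = ⊤
  · have := key2 ∅ (by simp) isCompact_empty
    rw [hAt] at this ⊢
    simpa using this
  by_contra hcon
  push Not at hcon
  rw [hB.measure_eq_iSup_isCompact] at hcon
  simp only [ENNReal.mul_iSup] at hcon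
  rw [add_comm] at hcon
  have : volume C - ENNReal.ofReal a * volume A < ⨆ K, ⨆ (_ : K ⊆ B), ⨆ (_ : IsCompact K), ENNReal.ofReal b * volume K := by
    refine ENNReal.sub_lt_of_lt_add ?_ hcon
    simpa using key2 ∅ (by simp) isCompact_empty
  simp only [lt_iSup_iff] at this
  obtain ⟨K, hK, hKc, hlt⟩ := this
  have := key2 K hK hKc
  rw [add_comm] at this
  exact absurd hlt (not_lt.2 (ENNReal.le_sub_of_add_le_right hAt this))

lemma amgm {a b : ℝ} (ha : 0 < a) (hb : 0 < b) (hab : a + b = 1) (x y : ENNReal) :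
    x ^ a * y ^ b ≤ ENNReal.ofReal a * x + ENNReal.ofReal b * y := by
  by_cases hx : x = ⊤
  · simp [hx, ENNReal.mul_top, ha]
  by_cases hy : y = ⊤
  · simp [hy, ENNReal.mul_top, hb]
  lift x to NNReal using hx
  lift y to NNReal using hy
  have := NNReal.geom_mean_le_arith_mean2_weighted a.toNNReal b.toNNReal x y
    (by rw [← Real.toNNReal_add ha.le hb.le, hab]; simp)
  rw [← ENNReal.coe_rpow_of_nonneg _ ha.le, ← ENNReal.coe_rpow_of_nonneg _ hb.le]
  simp only [ENNReal.ofReal]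
  rw [Real.coe_toNNReal _ ha.le, Real.coe_toNNReal _ hb.le] at this
  exact_mod_cast this

lemma layer {f : ℝ → ENNReal} (hf : Measurable f) (hf1 : ∀ x, f x ≤ 1) :
    ∫⁻ x, f x = ∫⁻ t in Set.Ioi (0:ℝ), volume {x | ENNReal.ofReal t < f x} := by
  have h1 : ∀ x, f x ≠ ⊤ := fun x => ne_top_of_le_ne_top (by simp) (hf1 x)
  have := lintegral_eq_lintegral_meas_lt (f := fun x => (f x).toReal) volume
    (Filter.Eventually.of_forall fun x => ENNReal.toReal_nonneg) hf.ennreal_toReal.aemeasurable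
  simp only [ENNReal.ofReal_toReal (h1 _)] at this
  rw [this]
  apply setLIntegral_congr_fun measurableSet_Ioi
  intro t ht
  simp only
  congr 1
  ext x
  simp only [Set.mem_ofPred_eq]
  rw [ENNReal.ofReal_lt_iff_lt_toReal (le_of_lt ht) (h1 x)]

lemma pl_norm {f g h : ℝ → ENNReal} (hf : Measurable f) (hg : Measurable g) (hh : Measurable h)
    (hf1 : ⨆ x, f x = 1) (hg1 : ⨆ x, g x = 1) {a b : ℝ} (ha : 0 < a) (hb : 0 < b) (hab : a + b = 1)
    (H : ∀ x y, f x ^ a * g y ^ b ≤ h (a * x + b * y)) :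
    (∫⁻ x, f x) ^ a * (∫⁻ x, g x) ^ b ≤ ∫⁻ x, h x := by
  have hf2 : ∀ x, f x ≤ 1 := fun x => hf1 ▸ le_iSup f x
  have hg2 : ∀ x, g x ≤ 1 := fun x => hg1 ▸ le_iSup g x
  have hm : ∫⁻ x, min (h x) 1 ≤ ∫⁻ x, h x := lintegral_mono fun x => min_le_left _ _
  refine le_trans ?_ hm
  refine (amgm ha hb hab _ _).trans ?_
  rw [layer hf hf2, layer hg hg2, layer (hh.min measurable_const) (fun x => min_le_right _ _)]
  have anti : ∀ f : ℝ → ENNReal, Measurable fun t : ℝ => volume {x | ENNReal.ofReal t < f x} := by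
    intro f
    apply Antitone.measurable
    intro s t hst
    apply measure_mono
    intro x hx
    exact lt_of_le_of_lt (ENNReal.ofReal_le_ofReal hst) hx
  rw [← lintegral_const_mul _ (anti f), ← lintegral_const_mul _ (anti g),
    ← lintegral_add_left ((anti f).const_mul _)]
  apply setLIntegral_mono (anti _)
  intro t ht
  have ht : 0 < t := ht
  by_cases ht1 : 1 ≤ t
  · have e : ∀ f : ℝ → ENNReal, (∀ x, f x ≤ 1) → {x | ENNReal.ofReal t < f x} = ∅ := by
      intro f hf
      ext x
      simp only [Set.mem_ofPred_eq, Set.mem_empty_iff_false, iff_false, not_lt]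
      exact (hf x).trans (by simpa using ht1)
    rw [e f hf2, e g hg2]
    simp
  push Not at ht1
  have ht1' : ENNReal.ofReal t < 1 := by simpa using ht1
  apply bm_meas (measurableSet_lt measurable_const hf) (measurableSet_lt measurable_const hg) _ _ ha hb
  · intro x hx y hy
    simp only [Set.mem_ofPred_eq] at *
    rw [lt_min_iff]
    refine ⟨lt_of_lt_of_le ?_ (H x y), ht1'⟩
    calc ENNReal.ofReal t = ENNReal.ofReal t ^ a * ENNReal.ofReal t ^ b := by
          rw [← ENNReal.rpow_add _ _ (by simpa using ht) (by simp), hab, ENNReal.rpow_one]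
      _ < _ := ENNReal.mul_lt_mul (ENNReal.rpow_lt_rpow hx ha) (ENNReal.rpow_lt_rpow hy hb)
  · rw [← hf1, lt_iSup_iff] at ht1'
    exact ht1'
  · rw [← hg1, lt_iSup_iff] at ht1'
    exact ht1'

lemma pl_bdd {f g h : ℝ → ENNReal} (hf : Measurable f) (hg : Measurable g) (hh : Measurable h)
    {M : ENNReal} (hM : M ≠ ⊤)
    (hf1 : ∀ x, f x ≤ M) (hg1 : ∀ x, g x ≤ M) {a b : ℝ} (ha : 0 < a) (hb : 0 < b) (hab : a + b = 1)
    (H : ∀ x y, f x ^ a * g y ^ b ≤ h (a * x + b * y)) :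
    (∫⁻ x, f x) ^ a * (∫⁻ x, g x) ^ b ≤ ∫⁻ x, h x := by
  set F := ⨆ x, f x with hF
  set G := ⨆ x, g x with hG
  have hFt : F ≠ ⊤ := ne_top_of_le_ne_top hM (iSup_le hf1)
  have hGt : G ≠ ⊤ := ne_top_of_le_ne_top hM (iSup_le hg1)
  by_cases hF0 : F = 0
  · have : ∀ x, f x = 0 := by simpa [hF] using hF0
    simp [this, ha]
  by_cases hG0 : G = 0
  · have : ∀ x, g x = 0 := by simpa [hG] using hG0
    simp [this, hb]
  have := pl_norm (f := fun x => F⁻¹ * f x) (g := fun x => G⁻¹ * g x)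
    (h := fun x => (F⁻¹ ^ a * G⁻¹ ^ b) * h x) (hf.const_mul _) (hg.const_mul _) (hh.const_mul _)
    (by rw [← ENNReal.mul_iSup, ← hF, ENNReal.inv_mul_cancel hF0 hFt])
    (by rw [← ENNReal.mul_iSup, ← hG, ENNReal.inv_mul_cancel hG0 hGt]) ha hb hab
    (by
      intro x y
      rw [ENNReal.mul_rpow_of_nonneg _ _ ha.le, ENNReal.mul_rpow_of_nonneg _ _ hb.le]
      rw [mul_mul_mul_comm]
      gcongr
      exact H x y)
  rw [lintegral_const_mul _ hf, lintegral_const_mul _ hg, lintegral_const_mul _ hh,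
    ENNReal.mul_rpow_of_nonneg _ _ ha.le, ENNReal.mul_rpow_of_nonneg _ _ hb.le, mul_mul_mul_comm] at this
  refine (ENNReal.mul_le_mul_iff_right ?_ ?_).1 this
  · simp [ha, hb, ha.le, hb.le, hFt, hGt]
  · apply ENNReal.mul_ne_top <;> simp [ha, hb, ha.le, hb.le, hF0, hG0, ha.not_gt, hb.not_gt]

lemma pdf_lc {a b : ℝ} (ha : 0 < a) (hb : 0 < b) (hab : a + b = 1) (x y : ℝ) :
    gaussianPDF 0 1 x ^ a * gaussianPDF 0 1 y ^ b ≤ gaussianPDF 0 1 (a * x + b * y) := by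
  simp only [gaussianPDF]
  rw [ENNReal.ofReal_rpow_of_pos (gaussianPDFReal_pos _ _ _ (by simp)),
    ENNReal.ofReal_rpow_of_pos (gaussianPDFReal_pos _ _ _ (by simp)), ← ENNReal.ofReal_mul
    (Real.rpow_nonneg (gaussianPDFReal_nonneg _ _ _) _)]
  apply ENNReal.ofReal_le_ofReal
  simp only [gaussianPDFReal]
  set c := (√(2 * Real.pi * ((1 : NNReal) : ℝ)))⁻¹ with hc
  have hc0 : 0 < c := by positivity
  rw [Real.mul_rpow hc0.le (Real.exp_pos _).le, Real.mul_rpow hc0.le (Real.exp_pos _).le,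
    mul_mul_mul_comm, ← Real.rpow_add hc0, hab, Real.rpow_one, ← Real.exp_mul, ← Real.exp_mul,
    ← Real.exp_add]
  gcongr
  obtain rfl : b = 1 - a := by linarith
  simp only [NNReal.coe_one, sub_zero]
  nlinarith [mul_nonneg (mul_pos ha hb).le (sq_nonneg (x - y))]

lemma pdf_bdd (x : ℝ) : gaussianPDF 0 1 x ≤ ENNReal.ofReal (√(2 * Real.pi * ((1 : NNReal) : ℝ)))⁻¹ := by
  apply ENNReal.ofReal_le_ofReal
  simp only [gaussianPDFReal]
  apply mul_le_of_le_one_right (by positivity)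
  rw [Real.exp_le_one_iff]
  simp only [NNReal.coe_one, sub_zero]
  nlinarith [sq_nonneg x]

lemma pl_gauss {f g h : ℝ → ENNReal} (hf : Measurable f) (hg : Measurable g) (hh : Measurable h)
    (hf1 : ∀ x, f x ≤ 1) (hg1 : ∀ x, g x ≤ 1) {a b : ℝ} (ha : 0 < a) (hb : 0 < b) (hab : a + b = 1)
    (H : ∀ x y, f x ^ a * g y ^ b ≤ h (a * x + b * y)) :
    (∫⁻ x, f x ∂gaussianReal 0 1) ^ a * (∫⁻ x, g x ∂gaussianReal 0 1) ^ b
      ≤ ∫⁻ x, h x ∂gaussianReal 0 1 := by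
  have hm := measurable_gaussianPDF 0 1
  have e : ∀ f : ℝ → ENNReal, Measurable f → ∫⁻ x, f x ∂gaussianReal 0 1 = ∫⁻ x, gaussianPDF 0 1 x * f x := by
    intro f hf
    rw [gaussianReal_of_var_ne_zero _ (by simp), lintegral_withDensity_eq_lintegral_mul _ hm hf]
    rfl
  rw [e f hf, e g hg, e h hh]
  refine pl_bdd (hm.mul hf) (hm.mul hg) (hm.mul hh) ENNReal.ofReal_ne_top
    (M := ENNReal.ofReal (√(2 * Real.pi * ((1 : NNReal) : ℝ)))⁻¹) ?_ ?_ ha hb hab ?_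
  · intro x
    exact (mul_le_of_le_one_right (zero_le) (hf1 x)).trans (pdf_bdd x)
  · intro x
    exact (mul_le_of_le_one_right (zero_le) (hg1 x)).trans (pdf_bdd x)
  · intro x y
    simp only [Pi.mul_apply]
    rw [ENNReal.mul_rpow_of_nonneg _ _ ha.le, ENNReal.mul_rpow_of_nonneg _ _ hb.le,
      mul_mul_mul_comm]
    exact mul_le_mul' (pdf_lc ha hb hab x y) (H x y)

lemma lint_succ {n : ℕ} {f : (Fin (n+1) → ℝ) → ENNReal} (hf : Measurable f) :
    ∫⁻ x, f x ∂Measure.pi (fun _ : Fin (n+1) => gaussianReal 0 1) =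
      ∫⁻ s, ∫⁻ x, f (Fin.cons s x) ∂Measure.pi (fun _ : Fin n => gaussianReal 0 1) ∂gaussianReal 0 1 := by
  have := (measurePreserving_piFinSuccAbove (fun _ : Fin (n+1) => gaussianReal 0 1) 0).symm
  rw [← this.lintegral_comp hf, lintegral_prod]
  · simp [MeasurableEquiv.piFinSuccAbove, Fin.insertNthEquiv]
  · exact (hf.comp (MeasurableEquiv.measurable _)).aemeasurable

lemma meas_cons {n : ℕ} : Measurable (fun p : ℝ × (Fin n → ℝ) => (Fin.cons p.1 p.2 : Fin (n+1) → ℝ)) := by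
  rw [measurable_pi_iff]
  intro i
  refine Fin.cases ?_ (fun j => ?_) i
  · simpa using measurable_fst
  · simp only [Fin.cons_succ]
    fun_prop

lemma pl_pi (n : ℕ) {f g h : (Fin n → ℝ) → ENNReal} (hf : Measurable f) (hg : Measurable g) (hh : Measurable h)
    (hf1 : ∀ x, f x ≤ 1) (hg1 : ∀ x, g x ≤ 1) {a b : ℝ} (ha : 0 < a) (hb : 0 < b) (hab : a + b = 1)
    (H : ∀ x y, f x ^ a * g y ^ b ≤ h (a • x + b • y)) :
    (∫⁻ x, f x ∂Measure.pi (fun _ : Fin n => gaussianReal 0 1)) ^ a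
        * (∫⁻ x, g x ∂Measure.pi (fun _ : Fin n => gaussianReal 0 1)) ^ b
      ≤ ∫⁻ x, h x ∂Measure.pi (fun _ : Fin n => gaussianReal 0 1) := by
  induction n with
  | zero =>
    rw [Measure.pi_of_empty, lintegral_dirac, lintegral_dirac, lintegral_dirac]
    refine (H _ _).trans (le_of_eq ?_)
    congr 1
    exact Subsingleton.elim _ _
  | succ n ih =>
    rw [lint_succ hf, lint_succ hg, lint_succ hh]
    have m2 : ∀ f : (Fin (n+1) → ℝ) → ENNReal, Measurable f → Measurable fun s : ℝ =>
        ∫⁻ x, f (Fin.cons s x) ∂Measure.pi (fun _ : Fin n => gaussianReal 0 1) := by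
      intro f hf
      exact (hf.comp meas_cons).lintegral_prod_right'
    have m1 : ∀ f : (Fin (n+1) → ℝ) → ENNReal, Measurable f → ∀ s : ℝ, Measurable fun x : Fin n → ℝ =>
        f (Fin.cons s x) := by
      intro f hf s
      exact (hf.comp meas_cons).comp measurable_prodMk_left
    have bd : ∀ f : (Fin (n+1) → ℝ) → ENNReal, (∀ x, f x ≤ 1) → ∀ s : ℝ, 
        ∫⁻ x, f (Fin.cons s x) ∂Measure.pi (fun _ : Fin n => gaussianReal 0 1) ≤ 1 := by
      intro f hf s
      exact (lintegral_mono fun x => hf _).trans (by simp)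
    refine pl_gauss (m2 f hf) (m2 g hg) (m2 h hh) (bd f hf1) (bd g hg1) ha hb hab ?_
    intro s t
    refine ih (m1 f hf s) (m1 g hg t) (m1 h hh _) (fun _ => hf1 _) (fun _ => hg1 _) ?_
    intro x y
    refine (H _ _).trans (le_of_eq ?_)
    congr 1
    ext i
    refine Fin.cases ?_ (fun j => ?_) i <;> simp

lemma gauss_lin {n : ℕ} (c : Fin n → ℝ) :
    (Measure.pi (fun _ : Fin n => gaussianReal 0 1)).map (fun x => ∑ i, c i * x i) =
      gaussianReal 0 (Real.toNNReal (∑ i, c i ^ 2)) := by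
  have hm : Measurable (fun x : Fin n → ℝ => ∑ i, c i * x i) := by fun_prop
  have := Measure.isProbabilityMeasure_map (μ := Measure.pi (fun _ : Fin n => gaussianReal 0 1)) hm.aemeasurable
  apply Measure.ext_of_charFun
  ext t
  rw [charFun_gaussianReal, charFun_apply_real, integral_map hm.aemeasurable (by fun_prop)]
  have e : ∀ x : Fin n → ℝ, Complex.exp (t * ((∑ i, c i * x i : ℝ) : ℂ) * Complex.I) =
      ∏ i, Complex.exp (((t * c i : ℝ) : ℂ) * (x i) * Complex.I) := by
    intro x
    rw [← Complex.exp_sum]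
    congr 1
    push_cast
    rw [Finset.mul_sum, Finset.sum_mul]
    exact Finset.sum_congr rfl fun i _ => by ring
  simp_rw [e]
  rw [integral_fintype_prod_eq_prod (fun i (x : ℝ) => Complex.exp (((t * c i : ℝ) : ℂ) * x * Complex.I))]
  simp_rw [← charFun_apply_real, charFun_gaussianReal]
  rw [← Complex.exp_sum]
  congr 1
  rw [Real.coe_toNNReal _ (Finset.sum_nonneg fun i _ => sq_nonneg _)]
  push_cast
  simp only [mul_zero, zero_mul, zero_sub, Finset.sum_mul, Finset.sum_div, Finset.sum_neg_distrib]
  congr 1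
  exact Finset.sum_congr rfl fun i _ => by ring

lemma gauss_uniq {n : ℕ} {S : Matrix (Fin n) (Fin n) ℝ} {μ ν : Measure (Fin n → ℝ)}
    (hμ : IsCenteredGaussianWithCov μ S) (hν : IsCenteredGaussianWithCov ν S) : μ = ν := by
  have := hμ.1
  have := hν.1
  apply Measure.ext_of_charFunDual
  ext L
  rw [charFunDual_eq_charFun_map_one, charFunDual_eq_charFun_map_one]
  have : (L : (Fin n → ℝ) → ℝ) = fun x => ∑ i, L (Pi.single i 1) * x i := by
    ext x
    conv_lhs => rw [← Finset.univ_sum_single x]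
    rw [map_sum]
    refine Finset.sum_congr rfl fun i _ => ?_
    have : (Pi.single i (x i) : Fin n → ℝ) = x i • Pi.single i 1 := by
      rw [← Pi.single_smul]; simp
    rw [this, map_smul, smul_eq_mul, mul_comm]
  rw [this, hμ.2, hν.2]

lemma gauss_map {n m : ℕ} (A : Fin n → Fin m → ℝ) (S : Matrix (Fin n) (Fin n) ℝ)
    (hS : ∀ i j, S i j = ∑ k, A i k * A j k) :
    IsCenteredGaussianWithCov ((Measure.pi (fun _ : Fin m => gaussianReal 0 1)).map
      (fun y i => ∑ k, A i k * y k)) S := by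
  have hm : Measurable (fun (y : Fin m → ℝ) (i : Fin n) => ∑ k, A i k * y k) := by fun_prop
  refine ⟨Measure.isProbabilityMeasure_map hm.aemeasurable, fun c => ?_⟩
  rw [Measure.map_map (by fun_prop) hm]
  have : ((fun x : Fin n → ℝ => ∑ i, c i * x i) ∘ fun (y : Fin m → ℝ) (i : Fin n) => ∑ k, A i k * y k)
      = fun y => ∑ k, (∑ i, c i * A i k) * y k := by
    ext y
    simp only [Function.comp, Finset.mul_sum, Finset.sum_mul]
    rw [Finset.sum_comm]
    exact Finset.sum_congr rfl fun i _ => Finset.sum_congr rfl fun k _ => by ring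
  rw [this, gauss_lin]
  congr 2
  simp only [hS, sq, Finset.sum_mul, Finset.mul_sum]
  rw [Finset.sum_comm]
  refine Finset.sum_congr rfl fun i _ => ?_
  rw [Finset.sum_comm]
  exact Finset.sum_congr rfl fun i _ => Finset.sum_congr rfl fun k _ => by ring

lemma gauss_std {n : ℕ} : IsCenteredGaussianWithCov (Measure.pi (fun _ : Fin n => gaussianReal 0 1)) 1 := by
  have := gauss_map (fun i k : Fin n => (1 : Matrix (Fin n) (Fin n) ℝ) i k) 1
    (by intro i j; simp [Matrix.one_apply, eq_comm])
  simpa [Matrix.one_apply] using this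

lemma gauss_tail {n : ℕ} {S : Matrix (Fin (n+1)) (Fin (n+1)) ℝ} {μ : Measure (Fin (n+1) → ℝ)}
    (hμ : IsCenteredGaussianWithCov μ S) :
    IsCenteredGaussianWithCov (μ.map (fun x (i : Fin n) => x i.succ)) (S.submatrix Fin.succ Fin.succ) := by
  have := hμ.1
  have hm : Measurable (fun (x : Fin (n+1) → ℝ) (i : Fin n) => x i.succ) := by fun_prop
  refine ⟨Measure.isProbabilityMeasure_map hm.aemeasurable, fun c => ?_⟩
  rw [Measure.map_map (by fun_prop) hm]
  have := hμ.2 (Fin.cons 0 c)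
  simpa [Fin.sum_univ_succ, Function.comp_def] using this

lemma pi_neg {n : ℕ} : (Measure.pi (fun _ : Fin n => gaussianReal 0 1)).map (fun x => -x) =
    Measure.pi (fun _ : Fin n => gaussianReal 0 1) := by
  have := gauss_map (fun i k : Fin n => -(1 : Matrix (Fin n) (Fin n) ℝ) i k) 1
    (by intro i j; simp [Matrix.one_apply, eq_comm])
  have := gauss_uniq this gauss_std
  simpa [Matrix.one_apply, Finset.sum_neg_distrib, Pi.neg_def] using this

def slabs {n m : ℕ} (a : Fin n → ℝ) (v : Fin n → Fin m → ℝ) (t : ℝ) (s : ℝ) : Set (Fin m → ℝ) :=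
  {x | ∀ i, |a i * s + ∑ k, v i k * x k| ≤ t}

lemma slabs_meas {n m : ℕ} (a : Fin n → ℝ) (v : Fin n → Fin m → ℝ) (t : ℝ) (s : ℝ) :
    MeasurableSet (slabs a v t s) := by
  unfold slabs
  simp only [Set.ofPred_forall]
  refine MeasurableSet.iInter fun i => measurableSet_le (by fun_prop) measurable_const

lemma slabs_neg {n m : ℕ} (a : Fin n → ℝ) (v : Fin n → Fin m → ℝ) (t : ℝ) (s : ℝ) :
    Measure.pi (fun _ : Fin m => gaussianReal 0 1) (slabs a v t (-s)) =
    Measure.pi (fun _ : Fin m => gaussianReal 0 1) (slabs a v t s) := by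
  conv_rhs => rw [← pi_neg, Measure.map_apply measurable_neg (slabs_meas _ _ _ _)]
  congr 1
  ext x
  simp only [slabs, Set.mem_ofPred_eq, Set.mem_preimage]
  refine forall_congr' fun i => ?_
  rw [← abs_neg]
  simp [add_comm]

lemma slabs_anti {n m : ℕ} (a : Fin n → ℝ) (v : Fin n → Fin m → ℝ) (t : ℝ) {s r : ℝ} (h : |s| ≤ |r|) :
    Measure.pi (fun _ : Fin m => gaussianReal 0 1) (slabs a v t r) ≤
    Measure.pi (fun _ : Fin m => gaussianReal 0 1) (slabs a v t s) := by
  by_cases h1 : |s| = |r|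
  · rcases abs_eq_abs.1 h1 with rfl | rfl
    · rfl
    · rw [slabs_neg]
  have hlt : |s| < |r| := lt_of_le_of_ne h h1
  have hr0 : 0 < |r| := (abs_nonneg s).trans_lt hlt
  have hr : r ≠ 0 := abs_pos.1 hr0
  have hq : |s / r| < 1 := by rw [abs_div, div_lt_one hr0]; exact hlt
  rw [abs_lt] at hq
  set α := (1 + s / r) / 2 with hα
  set β := (1 - s / r) / 2 with hβ
  have hα0 : 0 < α := by rw [hα]; linarith
  have hβ0 : 0 < β := by rw [hβ]; linarith
  have hab : α + β = 1 := by rw [hα, hβ]; ring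
  have hs : s = α * r + β * (-r) := by rw [hα, hβ]; field_simp; ring
  have := pl_pi m (f := (slabs a v t r).indicator 1) (g := (slabs a v t (-r)).indicator 1)
    (h := (slabs a v t s).indicator 1) (measurable_one.indicator (slabs_meas _ _ _ _))
    (measurable_one.indicator (slabs_meas _ _ _ _)) (measurable_one.indicator (slabs_meas _ _ _ _))
    (fun x => Set.indicator_le_self' (by simp) x) (fun x => Set.indicator_le_self' (by simp) x)
    hα0 hβ0 hab ?_
  · rw [lintegral_indicator_one (slabs_meas _ _ _ _), lintegral_indicator_one (slabs_meas _ _ _ _),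
      lintegral_indicator_one (slabs_meas _ _ _ _), slabs_neg, ← ENNReal.rpow_add_of_nonneg _ _ hα0.le hβ0.le,
      hab, ENNReal.rpow_one] at this
    exact this
  · intro x y
    by_cases hx : x ∈ slabs a v t r
    swap
    · simp [hx, hα0]
    by_cases hy : y ∈ slabs a v t (-r)
    swap
    · simp [hy, hβ0]
    have : α • x + β • y ∈ slabs a v t s := by
      intro i
      have e : a i * s + ∑ k, v i k * (α • x + β • y) k =
          α * (a i * r + ∑ k, v i k * x k) + β * (a i * (-r) + ∑ k, v i k * y k) := by
        have : ∑ k, v i k * (α • x + β • y) k = α * ∑ k, v i k * x k + β * ∑ k, v i k * y k := by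
          rw [Finset.mul_sum, Finset.mul_sum, ← Finset.sum_add_distrib]
          refine Finset.sum_congr rfl fun k _ => ?_
          simp
          ring
        rw [this]
        nth_rewrite 1 [hs]
        ring
      rw [e]
      have h1 := abs_le.1 (hx i)
      have h2 := abs_le.1 (hy i)
      obtain hβ' : β = 1 - α := by linarith
      rw [hβ'] at hβ0 ⊢
      rw [abs_le]
      constructor <;> nlinarith
    simp [hx, hy, this]

lemma cheb {φ : ℝ → ENNReal} (hanti : ∀ s r, |s| ≤ |r| → φ r ≤ φ s)
    (t : ℝ) (ht : 0 ≤ t) :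
    gaussianReal 0 1 {s | |s| ≤ t} * ∫⁻ s, φ s ∂gaussianReal 0 1 ≤
      ∫⁻ s in {s | |s| ≤ t}, φ s ∂gaussianReal 0 1 := by
  have hI : MeasurableSet {s : ℝ | |s| ≤ t} := measurableSet_le (by fun_prop) measurable_const
  set I := {s : ℝ | |s| ≤ t}
  set p := gaussianReal 0 1 I
  have h1 : φ t * p ≤ ∫⁻ s in I, φ s ∂gaussianReal 0 1 := by
    rw [← setLIntegral_const]
    exact setLIntegral_mono' hI fun s hs => hanti _ _ (by rw [abs_of_nonneg ht]; exact hs)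
  have h2 : ∫⁻ s in Iᶜ, φ s ∂gaussianReal 0 1 ≤ φ t * gaussianReal 0 1 Iᶜ := by
    rw [← setLIntegral_const]
    refine setLIntegral_mono' hI.compl fun s hs => hanti _ _ ?_
    rw [abs_of_nonneg ht]
    have hs' : ¬ |s| ≤ t := hs
    exact (not_le.1 hs').le
  have h3 : p + gaussianReal 0 1 Iᶜ = 1 := by
    rw [measure_add_measure_compl hI]; simp
  rw [← lintegral_add_compl _ hI]
  calc p * (∫⁻ s in I, φ s ∂gaussianReal 0 1 + ∫⁻ s in Iᶜ, φ s ∂gaussianReal 0 1)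
      ≤ p * (∫⁻ s in I, φ s ∂gaussianReal 0 1 + φ t * gaussianReal 0 1 Iᶜ) := by gcongr
    _ = p * ∫⁻ s in I, φ s ∂gaussianReal 0 1 + (φ t * p) * gaussianReal 0 1 Iᶜ := by ring
    _ ≤ p * ∫⁻ s in I, φ s ∂gaussianReal 0 1 + (∫⁻ s in I, φ s ∂gaussianReal 0 1) * gaussianReal 0 1 Iᶜ := by gcongr
    _ = (p + gaussianReal 0 1 Iᶜ) * ∫⁻ s in I, φ s ∂gaussianReal 0 1 := by ring
    _ = _ := by rw [h3, one_mul]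

lemma quad {n : ℕ} {S : Matrix (Fin n) (Fin n) ℝ} (x : Fin n → ℝ) :
    star x ⬝ᵥ S.mulVec x = ∑ i, ∑ j, x i * S i j * x j := by
  simp [dotProduct, Matrix.mulVec, Finset.mul_sum, mul_assoc]

lemma factor {n : ℕ} (S : Matrix (Fin (n+1)) (Fin (n+1)) ℝ) (hS : S.PosSemidef) (h0 : S 0 0 = 1) :
    ∃ (m : ℕ) (v : Fin n → Fin m → ℝ), ∀ i j, S (Fin.succ i) (Fin.succ j) =
      S i.succ 0 * S j.succ 0 + ∑ k, v i k * v j k := by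
  have hsym : ∀ i j, S i j = S j i := fun i j => by
    have := hS.1.apply i j
    simpa using this.symm
  let T : Matrix (Fin n) (Fin n) ℝ := fun i j => S i.succ j.succ - S i.succ 0 * S j.succ 0
  have hT : T.PosSemidef := by
    apply Matrix.PosSemidef.of_dotProduct_mulVec_nonneg
    · ext i j
      rw [Matrix.conjTranspose_apply, star_trivial]
      simp only [T]
      rw [hsym i.succ j.succ]; ring
    · intro c
      have := hS.dotProduct_mulVec_nonneg (Fin.cons (-∑ i, c i * S i.succ 0) c)
      rw [quad] at this ⊢
      refine this.trans (le_of_eq ?_)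
      simp only [Fin.sum_univ_succ, Fin.cons_zero, Fin.cons_succ, h0, T]
      set q := ∑ i, c i * S i.succ 0 with hq
      have e1 : ∑ j : Fin n, -q * S 0 j.succ * c j = - q * q := by
        rw [hq, Finset.mul_sum]
        refine Finset.sum_congr rfl fun i _ => ?_
        rw [hsym 0 i.succ]; ring
      have e2 : ∑ i : Fin n, (c i * S i.succ 0 * -q + ∑ j : Fin n, c i * S i.succ j.succ * c j) =
        - q * q + ∑ i : Fin n, ∑ j : Fin n, c i * S i.succ j.succ * c j := by
        rw [Finset.sum_add_distrib, ← Finset.sum_mul, ← hq]; ring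
      have e3 : ∑ i : Fin n, ∑ j : Fin n, c i * (S i.succ j.succ - S i.succ 0 * S j.succ 0) * c j =
         ∑ i : Fin n, ∑ j : Fin n, c i * S i.succ j.succ * c j - q * q := by
        rw [hq, Finset.sum_mul_sum, ← Finset.sum_sub_distrib]
        refine Finset.sum_congr rfl fun i _ => ?_
        rw [← Finset.sum_sub_distrib]
        exact Finset.sum_congr rfl fun j _ => by ring
      rw [e1, e2, e3]
      ring
  obtain ⟨m, v, hv⟩ := Matrix.posSemidef_iff_eq_sum_vecMulVec.1 hT
  refine ⟨m, fun i k => v k i, fun i j => ?_⟩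
  have := congrFun (congrFun hv i) j
  simp only [T, Matrix.sum_apply, Matrix.vecMulVec_apply, Pi.star_apply, star_trivial] at this
  linarith

lemma sidak (n : ℕ) (S : Matrix (Fin n) (Fin n) ℝ)
    (hpsd : S.PosSemidef) (hdiag : ∀ i, S i i = 1)
    (μ : Measure (Fin n → ℝ)) (hμ : IsCenteredGaussianWithCov μ S) (t : ℝ) (ht : 0 ≤ t) :
    (gaussianReal 0 1 {s | |s| ≤ t}) ^ n ≤ μ {x | ∀ i, |x i| ≤ t} := by
  induction n with
  | zero => have := hμ.1; simp
  | succ n ih =>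
    have h1 := ih _ (hpsd.submatrix Fin.succ) (fun i => hdiag _) _ (gauss_tail hμ)
    obtain ⟨m, v, hv⟩ := factor S hpsd (hdiag 0)
    have hsym : ∀ i j, S i j = S j i := fun i j => by
      have := hpsd.1.apply i j
      simpa using this.symm
    let A : Fin (n+1) → Fin (m+1) → ℝ := Fin.cons (Fin.cons 1 0) (fun i => Fin.cons (S i.succ 0) (v i))
    have hA := gauss_map A S (by
      intro i j
      refine Fin.cases ?_ (fun i => ?_) i <;> refine Fin.cases ?_ (fun j => ?_) j
      · simp [A, Fin.sum_univ_succ, hdiag]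
      · simp [A, Fin.sum_univ_succ, hsym 0]
      · simp [A, Fin.sum_univ_succ]
      · simp [A, Fin.sum_univ_succ, hv])
    obtain rfl := gauss_uniq hμ hA
    have hbox : ∀ n, MeasurableSet {x : Fin n → ℝ | ∀ i, |x i| ≤ t} := by
      intro n
      simp only [Set.ofPred_forall]
      exact MeasurableSet.iInter fun i => measurableSet_le (by fun_prop) measurable_const
    have hI : MeasurableSet {s : ℝ | |s| ≤ t} := measurableSet_le (by fun_prop) measurable_const
    have hm : Measurable (fun (y : Fin (m+1) → ℝ) (i : Fin (n+1)) => ∑ k, A i k * y k) := by fun_prop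
    let φ : ℝ → ENNReal := fun s =>
      Measure.pi (fun _ : Fin m => gaussianReal 0 1) (slabs (fun i => S i.succ 0) v t s)
    have hm2 : Measurable (fun (x : Fin (n+1) → ℝ) (i : Fin n) => x i.succ) := by fun_prop
    rw [Measure.map_map hm2 hm, Measure.map_apply (hm2.comp hm) (hbox n)] at h1
    rw [Measure.map_apply hm (hbox _)]
    have e1 : Measure.pi (fun _ : Fin (m+1) => gaussianReal 0 1)
        (((fun (x : Fin (n+1) → ℝ) (i : Fin n) => x i.succ) ∘ fun (y : Fin (m+1) → ℝ) (i : Fin (n+1)) => ∑ k, A i k * y k) ⁻¹' {x : Fin n → ℝ | ∀ i, |x i| ≤ t})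
        = ∫⁻ s, φ s ∂gaussianReal 0 1 := by
      rw [← lintegral_indicator_one ((hm2.comp hm) (hbox n)), lint_succ (measurable_one.indicator ((hm2.comp hm) (hbox n)))]
      refine lintegral_congr fun s => ?_
      simp only [φ]
      rw [← lintegral_indicator_one (slabs_meas _ _ _ _)]
      refine lintegral_congr fun x => ?_
      refine Set.indicator_const_eq_indicator_const ?_
      simp [slabs, A, Fin.sum_univ_succ]
    have e2 : Measure.pi (fun _ : Fin (m+1) => gaussianReal 0 1)
        ((fun (y : Fin (m+1) → ℝ) (i : Fin (n+1)) => ∑ k, A i k * y k) ⁻¹' {x : Fin (n+1) → ℝ | ∀ i, |x i| ≤ t})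
        = ∫⁻ s in {s | |s| ≤ t}, φ s ∂gaussianReal 0 1 := by
      rw [← lintegral_indicator_one (hm (hbox _)), lint_succ (measurable_one.indicator (hm (hbox _))),
        ← lintegral_indicator hI]
      refine lintegral_congr fun s => ?_
      by_cases hs : s ∈ {s : ℝ | |s| ≤ t}
      · rw [Set.indicator_of_mem hs]
        simp only [φ]
        rw [← lintegral_indicator_one (slabs_meas _ _ _ _)]
        refine lintegral_congr fun x => ?_
        refine Set.indicator_const_eq_indicator_const ?_
        have : |s| ≤ t := hs
        simp [slabs, A, Fin.sum_univ_succ, Fin.forall_fin_succ, this]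
      · rw [Set.indicator_of_notMem hs]
        rw [← lintegral_zero (μ := Measure.pi (fun _ : Fin m => gaussianReal 0 1))]
        refine lintegral_congr fun x => ?_
        apply Set.indicator_of_notMem
        have : ¬ |s| ≤ t := hs
        simp [A, Fin.sum_univ_succ, Fin.forall_fin_succ, this]
    rw [e1] at h1
    rw [e2]
    refine le_trans ?_ (cheb (φ := φ) (fun s r h => slabs_anti _ _ _ h) t ht)
    rw [pow_succ']
    gcongr

lemma std_box (n : ℕ) (t : ℝ) : Measure.pi (fun _ : Fin n => gaussianReal 0 1) {x | ∀ i, |x i| ≤ t} =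
    (gaussianReal 0 1 {s | |s| ≤ t}) ^ n := by
  have : {x : Fin n → ℝ | ∀ i, |x i| ≤ t} = Set.univ.pi fun _ => {s | |s| ≤ t} := by
    ext x; simp
  rw [this, Measure.pi_pi]
  simp

lemma std_int (n : ℕ) : Integrable (fun x : Fin n → ℝ => ‖x‖) (Measure.pi (fun _ : Fin n => gaussianReal 0 1)) := by
  have h1 : Integrable (fun s : ℝ => |s|) (gaussianReal 0 1) := by
    have : MemLp id 1 (gaussianReal 0 1) := memLp_id_gaussianReal 1
    exact (memLp_one_iff_integrable.1 this).abs
  have h2 : Integrable (fun x : Fin n → ℝ => ∑ i, |x i|) (Measure.pi (fun _ : Fin n => gaussianReal 0 1)) := by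
    refine integrable_finsetSum _ fun i _ => ?_
    exact (measurePreserving_eval (fun _ : Fin n => gaussianReal 0 1) i).integrable_comp_of_integrable h1
  refine h2.mono' (by fun_prop) (Filter.Eventually.of_forall fun x => ?_)
  rw [norm_norm, pi_norm_le_iff_of_nonneg (Finset.sum_nonneg fun i _ => abs_nonneg _)]
  intro i
  exact Finset.single_le_sum (f := fun i => |x i|) (fun i _ => abs_nonneg _) (Finset.mem_univ i)

/-- The expected maximum absolute coordinate (i.e. the sup norm, since the `Pi` norm on
`Fin n → ℝ` is `max_i |x_i|`) of a centered Gaussian vector with unit variances is maximized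
by the standard Gaussian (identity covariance, i.e. `n` i.i.d. standard Gaussians). -/
theorem stmt9 {n : ℕ} (hn : 1 ≤ n) (S : Matrix (Fin n) (Fin n) ℝ)
    (hpsd : S.PosSemidef) (hdiag : ∀ i, S i i = 1)
    (μ : Measure (Fin n → ℝ)) (hμ : IsCenteredGaussianWithCov μ S)
    (ν : Measure (Fin n → ℝ)) (hν : IsCenteredGaussianWithCov ν 1) :
    ∫ x, ‖x‖ ∂μ ≤ ∫ x, ‖x‖ ∂ν := by
  obtain rfl := gauss_uniq hν gauss_std
  have := hμ.1
  have hlin : ∫⁻ x, ENNReal.ofReal ‖x‖ ∂μ ≤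
      ∫⁻ x, ENNReal.ofReal ‖x‖ ∂Measure.pi (fun _ : Fin n => gaussianReal 0 1) := by
    rw [lintegral_eq_lintegral_meas_lt _ (Filter.Eventually.of_forall fun x => norm_nonneg _) (by fun_prop),
      lintegral_eq_lintegral_meas_lt _ (Filter.Eventually.of_forall fun x => norm_nonneg _) (by fun_prop)]
    refine setLIntegral_mono' measurableSet_Ioi fun t ht => ?_
    have ht : 0 ≤ t := le_of_lt ht
    have e : {x : Fin n → ℝ | t < ‖x‖} = {x | ∀ i, |x i| ≤ t}ᶜ := by
      ext x
      rw [Set.mem_compl_iff, Set.mem_ofPred_eq, Set.mem_ofPred_eq, ← not_le,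
        pi_norm_le_iff_of_nonneg ht]
      rfl
    have hbox : MeasurableSet {x : Fin n → ℝ | ∀ i, |x i| ≤ t} := by
      simp only [Set.ofPred_forall]
      exact MeasurableSet.iInter fun i => measurableSet_le (by fun_prop) measurable_const
    rw [e, prob_compl_eq_one_sub hbox, prob_compl_eq_one_sub hbox, std_box]
    exact tsub_le_tsub_left (sidak n S hpsd hdiag μ hμ t ht) 1
  rw [integral_eq_lintegral_of_nonneg_ae (Filter.Eventually.of_forall fun x => norm_nonneg _) (by fun_prop),
    integral_eq_lintegral_of_nonneg_ae (Filter.Eventually.of_forall fun x => norm_nonneg _) (by fun_prop)]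
  refine ENNReal.toReal_mono ?_ hlin
  have := (std_int n).lintegral_lt_top
  exact this.ne
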